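/- Let U ⊆ ℝ² be open with coordinates (x₁,x₂) and let u : U → ℝ be a smooth solution of the sine-Gordon equation u_{x₁x₁} − u_{x₂x₂} = sin u. Then for every p₀ ∈ U and every φ₀ ∈ ℝ there exist an open neighborhood V ⊆ U of p₀ and a smooth function φ : V → ℝ with φ(p₀) = φ₀ satisfying the system φ_{x₁} = u_{x₂}/2 + sin φ · cos(u/2) and φ_{x₂} = u_{x₁}/2 + cos φ · sin(u/2) on V; moreover any two such solutions on a connected open neighborhood of p₀ agreeing at p₀ coincide. -/

import Mathlib

open Real

/-- Partial derivative in the first (`x₁`) coordinate. -/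
noncomputable def pd1 (f : ℝ × ℝ → ℝ) : ℝ × ℝ → ℝ := fun p => fderiv ℝ f p (1, 0)

/-- Partial derivative in the second (`x₂`) coordinate. -/
noncomputable def pd2 (f : ℝ × ℝ → ℝ) : ℝ × ℝ → ℝ := fun p => fderiv ℝ f p (0, 1)

/-- The angle system associated to the sine-Gordon equation, on a set `V`. -/
def SGAngleSystem (u φ : ℝ × ℝ → ℝ) (V : Set (ℝ × ℝ)) : Prop :=
  ∀ p ∈ V,
    pd1 φ p = pd2 u p / 2 + sin (φ p) * cos (u p / 2) ∧
    pd2 φ p = pd1 u p / 2 + cos (φ p) * sin (u p / 2)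


theorem PL_mem {f : ℝ → ℝ → ℝ} {tmin tmax : ℝ} {t₀ : Set.Icc tmin tmax} {x₀ : ℝ}
    {a L K : NNReal} (hf : IsPicardLindelof f t₀ x₀ a 0 L K) :
    ∃ α : ℝ → ℝ, α t₀ = x₀ ∧
      ∀ t ∈ Set.Icc tmin tmax, HasDerivWithinAt α (f t (α t)) (Set.Icc tmin tmax) t ∧
        α t ∈ Metric.closedBall x₀ a := by
  have hx : x₀ ∈ Metric.closedBall x₀ ((0 : NNReal) : ℝ) := by simp
  obtain ⟨α, hα⟩ := ODE.FunSpace.exists_isFixedPt_next hf hx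
  refine ⟨α.compProj, by rw [ODE.FunSpace.compProj_val, ← hα, ODE.FunSpace.next_apply₀],
    fun t ht ↦ ⟨?_, α.compProj_mem_closedBall hf.mul_max_le⟩⟩
  apply ODE.hasDerivWithinAt_picard_Icc t₀.2 hf.continuousOn_uncurry
    α.continuous_compProj.continuousOn (fun _ ht' ↦ α.compProj_mem_closedBall hf.mul_max_le)
    x₀ ht |>.congr_of_mem _ ht
  intro t' ht'
  nth_rw 1 [← hα]
  rw [ODE.FunSpace.compProj_of_mem ht', ODE.FunSpace.next_apply]

theorem gron_lin (K ε : ℝ) : gronwallBound 0 K ε 1 = ε * gronwallBound 0 K 1 1 := by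
  unfold gronwallBound
  split_ifs
  · ring
  · ring

section
variable {E : Type*} [NormedAddCommGroup E] [NormedSpace ℝ E]

theorem mem_ball_aux {p₀ v : E} {φ₀ r t s : ℝ} (hr : 0 < r) (hv : ‖v‖ < r) (ht : t ∈ Set.Icc (0:ℝ) 1)
    (hs : |s - φ₀| < r) : (p₀ + t • v, s) ∈ Metric.ball (p₀, φ₀) r := by
  rw [Metric.mem_ball, Prod.dist_eq, max_lt_iff]
  refine ⟨?_, by simpa [Real.dist_eq] using hs⟩
  simp only [dist_eq_norm, add_sub_cancel_left, norm_smul, Real.norm_eq_abs]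
  rw [abs_of_nonneg ht.1]
  nlinarith [ht.2, norm_nonneg v]

theorem frob_lip {F : E × ℝ → E →L[ℝ] ℝ} {p₀ v : E} {φ₀ r t ρ : ℝ} {K : NNReal} (hr : 0 < r)
    (hv : ‖v‖ < r) (hρ : 0 ≤ ρ) (hvρ : ‖v‖ ≤ ρ) (ht : t ∈ Set.Icc (0:ℝ) 1)
    (hK : LipschitzOnWith K F (Metric.ball (p₀, φ₀) r)) :
    LipschitzOnWith (K * ρ.toNNReal) (fun s => F (p₀ + t • v, s) v) {s | |s - φ₀| < r} := by
  apply LipschitzOnWith.of_dist_le_mul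
  intro a ha b hb
  have h1 := hK.dist_le_mul _ (mem_ball_aux (p₀ := p₀) hr hv ht ha) _
    (mem_ball_aux (p₀ := p₀) hr hv ht hb)
  rw [Prod.dist_eq, dist_self, max_eq_right dist_nonneg, dist_eq_norm] at h1
  rw [dist_eq_norm, ← sub_apply]
  refine (ContinuousLinearMap.le_opNorm _ _).trans ?_
  rw [NNReal.coe_mul, Real.coe_toNNReal _ hρ]
  calc _ ≤ (K * dist a b) * ρ := by gcongr
    _ = _ := by ring

theorem frob_sol {F : E × ℝ → E →L[ℝ] ℝ} {p₀ v : E} {φ₀ r ρ : ℝ} {M K : NNReal} (hr : 0 < r)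
    (hρ : 0 < ρ) (hρr : ρ < r) (hMρ : M * ρ ≤ r / 2)
    (hM : ∀ q ∈ Metric.ball (p₀, φ₀) r, ‖F q‖ ≤ M)
    (hK : LipschitzOnWith K F (Metric.ball (p₀, φ₀) r)) (hv : ‖v‖ < ρ) :
    ∃ z : ℝ → ℝ, z 0 = φ₀ ∧ ∀ t ∈ Set.Icc (0:ℝ) 1,
      HasDerivWithinAt z (F (p₀ + t • v, z t) v) (Set.Icc 0 1) t ∧ |z t - φ₀| ≤ r / 2 := by
  have hsub : ∀ s ∈ Metric.closedBall φ₀ ((r/2).toNNReal : ℝ), |s - φ₀| < r := by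
    intro s hs
    rw [Real.coe_toNNReal _ (by positivity), Metric.mem_closedBall, Real.dist_eq] at hs
    linarith
  have hPL : IsPicardLindelof (fun t s => F (p₀ + t • v, s) v)
      (⟨0, by simp⟩ : Set.Icc (0:ℝ) 1) φ₀ (r/2).toNNReal 0 (r/2).toNNReal (K * ρ.toNNReal) := by
    refine ⟨?_, ?_, ?_, ?_⟩
    · intro t ht
      exact (frob_lip hr (hv.trans hρr) hρ.le hv.le ht hK).mono hsub
    · intro s hs
      have : ContinuousOn (fun t : ℝ => F (p₀ + t • v, s)) (Set.Icc 0 1) := by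
        apply hK.continuousOn.comp (f := fun t : ℝ => (p₀ + t • v, s))
        · fun_prop
        · intro t ht
          exact mem_ball_aux hr (hv.trans hρr) ht (hsub s hs)
      exact this.clm_apply continuousOn_const
    · intro t ht s hs
      rw [Real.coe_toNNReal _ (by positivity)]
      refine (ContinuousLinearMap.le_opNorm _ _).trans (le_trans ?_ hMρ)
      have := hM _ (mem_ball_aux (p₀ := p₀) hr (hv.trans hρr) ht (hsub s hs))
      gcongr
    · simp
  obtain ⟨z, hz0, hz⟩ := PL_mem hPL
  refine ⟨z, hz0, fun t ht => ⟨(hz t ht).1, ?_⟩⟩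
  have := (hz t ht).2
  rwa [Real.coe_toNNReal _ (by positivity), Metric.mem_closedBall, Real.dist_eq] at this

theorem frob_est {F : E × ℝ → E →L[ℝ] ℝ} {p₀ v h : E} {φ₀ r ρ : ℝ} {M K L : NNReal} (hr : 0 < r)
    (hρ : 0 < ρ) (hρr : ρ < r)
    (hd : ∀ q ∈ Metric.ball (p₀, φ₀) r, DifferentiableAt ℝ F q)
    (hM : ∀ q ∈ Metric.ball (p₀, φ₀) r, ‖F q‖ ≤ M)
    (hK : LipschitzOnWith K F (Metric.ball (p₀, φ₀) r))
    (hL : LipschitzOnWith L (fderiv ℝ F) (Metric.ball (p₀, φ₀) r))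
    (hint : ∀ q ∈ Metric.ball (p₀, φ₀) r, ∀ a b : E,
      fderiv ℝ F q (a, F q a) b = fderiv ℝ F q (b, F q b) a)
    (hv : ‖v‖ < ρ) (hvh : ‖v + h‖ < ρ) (hh : M * ‖h‖ < r / 2)
    {z z' : ℝ → ℝ} (hz0 : z 0 = φ₀) (hz0' : z' 0 = φ₀)
    (hz : ∀ t ∈ Set.Icc (0:ℝ) 1,
      HasDerivWithinAt z (F (p₀ + t • v, z t) v) (Set.Icc 0 1) t ∧ |z t - φ₀| ≤ r / 2)
    (hz' : ∀ t ∈ Set.Icc (0:ℝ) 1,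
      HasDerivWithinAt z' (F (p₀ + t • (v + h), z' t) (v + h)) (Set.Icc 0 1) t ∧
        |z' t - φ₀| ≤ r / 2) :
    |z' 1 - z 1 - F (p₀ + v, z 1) h| ≤
      ((L * (1 + M) ^ 2 * ρ + K * (1 + M)) * gronwallBound 0 (K * ρ) 1 1) * ‖h‖ ^ 2 := by
  have hq0 : ∀ t ∈ Set.Icc (0:ℝ) 1, (p₀ + t • v, z t) ∈ Metric.ball (p₀, φ₀) r := fun t ht =>
    mem_ball_aux hr (hv.trans hρr) ht (by linarith [(hz t ht).2])
  have hFh : ∀ t ∈ Set.Icc (0:ℝ) 1, |F (p₀ + t • v, z t) h| ≤ M * ‖h‖ := fun t ht =>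
    (ContinuousLinearMap.le_opNorm (F (p₀ + t • v, z t)) h).trans
      (mul_le_mul_of_nonneg_right (hM _ (hq0 t ht)) (norm_nonneg h))
  set w : ℝ → ℝ := fun t => z t + t * F (p₀ + t • v, z t) h with hw
  have hwr : ∀ t ∈ Set.Icc (0:ℝ) 1, |w t - φ₀| < r := by
    intro t ht
    have h1 := (hz t ht).2
    have h2 : |t * F (p₀ + t • v, z t) h| ≤ M * ‖h‖ := by
      rw [abs_mul, abs_of_nonneg ht.1]
      nlinarith [hFh t ht, ht.2, abs_nonneg (F (p₀ + t • v, z t) h)]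
    have : w t - φ₀ = (z t - φ₀) + t * F (p₀ + t • v, z t) h := by simp only [hw]; ring
    rw [this]
    linarith [abs_add_le (z t - φ₀) (t * F (p₀ + t • v, z t) h)]
  have hq1 : ∀ t ∈ Set.Icc (0:ℝ) 1, (p₀ + t • (v + h), w t) ∈ Metric.ball (p₀, φ₀) r :=
    fun t ht => mem_ball_aux hr (hvh.trans hρr) ht (hwr t ht)
  -- derivative of `w`
  have hwd : ∀ t ∈ Set.Icc (0:ℝ) 1, HasDerivWithinAt w
      (F (p₀ + t • v, z t) v + (1 * F (p₀ + t • v, z t) h +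
        t * (fderiv ℝ F (p₀ + t • v, z t) (v, F (p₀ + t • v, z t) v)) h)) (Set.Icc 0 1) t := by
    intro t ht
    have h1 : HasDerivWithinAt (fun t : ℝ => (p₀ + t • v, z t)) (v, F (p₀ + t • v, z t) v)
        (Set.Icc 0 1) t := by
      have : HasDerivWithinAt (fun t : ℝ => p₀ + t • v) v (Set.Icc 0 1) t := by
        have := ((hasDerivWithinAt_id t (Set.Icc (0:ℝ) 1)).smul_const v).const_add p₀
        simpa using this
      exact this.prodMk (hz t ht).1
    have h2 := (hd _ (hq0 t ht)).hasFDerivAt.comp_hasDerivWithinAt t h1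
    have h3 := h2.clm_apply (hasDerivWithinAt_const t (Set.Icc (0:ℝ) 1) h)
    have h4 := (hz t ht).1.add ((hasDerivWithinAt_id t (Set.Icc (0:ℝ) 1)).mul h3)
    refine HasDerivWithinAt.congr_deriv h4 ?_
    simp
  have hnear : ∀ t ∈ Set.Ico (0:ℝ) 1, Set.Icc (0:ℝ) 1 ∈ nhdsWithin t (Set.Ici t) :=
    fun t ht => Icc_mem_nhdsGE_of_mem ht
  set C := L * (1 + M) ^ 2 * ρ + K * (1 + M) with hC
  have key := dist_le_of_approx_trajectories_ODE_of_mem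
    (v := fun t s => F (p₀ + t • (v + h), s) (v + h)) (s := fun _ => {s | |s - φ₀| < r})
    (K := K * ρ.toNNReal) (f := z') (g := w) (a := 0) (b := 1) (δ := 0) (εf := 0)
    (εg := C * ‖h‖ ^ 2)
    (fun t ht => frob_lip hr (hvh.trans hρr) hρ.le hvh.le ⟨ht.1, ht.2.le⟩ hK)
    (fun t ht => (hz' t ht).1.continuousWithinAt)
    (fun t ht => (hz' t ⟨ht.1, ht.2.le⟩).1.mono_of_mem_nhdsWithin (hnear t ht))
    (fun t ht => by simp)
    (fun t ht => by
      have := (hz' t ⟨ht.1, ht.2.le⟩).2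
      show |z' t - φ₀| < r
      linarith)
    (fun t ht => (hwd t ht).continuousWithinAt)
    (fun t ht => (hwd t ⟨ht.1, ht.2.le⟩).mono_of_mem_nhdsWithin (hnear t ht))
    (by
      intro t ht'
      have ht : t ∈ Set.Icc (0:ℝ) 1 := ⟨ht'.1, ht'.2.le⟩
      have e0 := hq0 t ht
      have e1 := hq1 t ht
      have hf := hFh t ht
      have hwt : w t = z t + t * F (p₀ + t • v, z t) h := rfl
      generalize hgq0 : (p₀ + t • v, z t) = q0 at *
      generalize hgq : (p₀ + t • (v + h), w t) = q at *
      have hdiff : q - q0 = t • (h, F q0 h) := by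
        have i1 : q0.1 = p₀ + t • v := by rw [← hgq0]
        have i2 : q0.2 = z t := by rw [← hgq0]
        have i3 : q.1 = p₀ + t • (v + h) := by rw [← hgq]
        have i4 : q.2 = w t := by rw [← hgq]
        apply Prod.ext
        · simp [i1, i3, smul_add]
        · simp [i2, i4, hwt]
      have hn1 : ‖(h, F q0 h)‖ ≤ (1 + M) * ‖h‖ := by
        rw [Prod.norm_def]
        apply max_le
        · nlinarith [norm_nonneg h, M.2]
        · simp only [Real.norm_eq_abs]
          linarith [norm_nonneg h]
      have hn : ‖q - q0‖ ≤ (1 + M) * ‖h‖ := by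
        rw [hdiff, norm_smul, Real.norm_eq_abs, abs_of_nonneg ht.1]
        nlinarith [ht.2, norm_nonneg (h, F q0 h)]
      have hseg : segment ℝ q0 q ⊆ Metric.ball (p₀, φ₀) r :=
        (convex_ball _ _).segment_subset e0 e1
      have hR : ‖F q - F q0 - fderiv ℝ F q0 (q - q0)‖ ≤ L * ‖q - q0‖ * ‖q - q0‖ := by
        apply Convex.norm_image_sub_le_of_norm_fderiv_le' (𝕜 := ℝ) (s := segment ℝ q0 q)
          (fun x hx => hd x (hseg hx)) _ (convex_segment _ _) (left_mem_segment ..)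
          (right_mem_segment ..)
        intro x hx
        have := hL.dist_le_mul _ (hseg hx) _ e0
        rw [dist_eq_norm, dist_eq_norm] at this
        refine this.trans ?_
        gcongr
        obtain ⟨θ, hθ, rfl⟩ := (segment_eq_image' ℝ q0 q ▸ hx)
        simp only [add_sub_cancel_left, norm_smul, Real.norm_eq_abs, abs_of_nonneg hθ.1]
        nlinarith [hθ.2, norm_nonneg (q - q0)]
      have hDK : ‖fderiv ℝ F q0‖ ≤ K :=
        norm_fderiv_le_of_lipschitzOn ℝ (Metric.isOpen_ball.mem_nhds e0) hK
      have hs := hint q0 e0 v h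
      have heq : F q0 v + (1 * F q0 h + t * fderiv ℝ F q0 (v, F q0 v) h) - F q (v + h)
          = -((F q - F q0 - fderiv ℝ F q0 (q - q0)) (v + h))
            - t * fderiv ℝ F q0 (h, F q0 h) h := by
        rw [hdiff, hs]
        simp only [map_smul, ContinuousLinearMap.sub_apply, ContinuousLinearMap.smul_apply,
          map_add, smul_eq_mul]
        ring
      rw [Real.dist_eq, heq]
      refine (abs_sub _ _).trans ?_
      rw [abs_neg, abs_mul, abs_of_nonneg ht.1]
      have b1 : |(F q - F q0 - fderiv ℝ F q0 (q - q0)) (v + h)|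
          ≤ (L * ((1 + M) * ‖h‖) * ((1 + M) * ‖h‖)) * ρ := by
        rw [← Real.norm_eq_abs]
        refine (ContinuousLinearMap.le_opNorm _ _).trans ?_
        have : ‖F q - F q0 - fderiv ℝ F q0 (q - q0)‖
            ≤ L * ((1 + M) * ‖h‖) * ((1 + M) * ‖h‖) := hR.trans (by gcongr)
        gcongr
      have b2 : |fderiv ℝ F q0 (h, F q0 h) h| ≤ (K * ((1 + M) * ‖h‖)) * ‖h‖ := by
        rw [← Real.norm_eq_abs]
        refine (ContinuousLinearMap.le_opNorm _ _).trans ?_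
        gcongr
        refine (ContinuousLinearMap.le_opNorm _ _).trans ?_
        gcongr
      have b3 : t * |fderiv ℝ F q0 (h, F q0 h) h| ≤ |fderiv ℝ F q0 (h, F q0 h) h| := by
        nlinarith [ht.2, abs_nonneg (fderiv ℝ F q0 (h, F q0 h) h)]
      rw [hC]
      nlinarith)
    (fun t ht => hwr t ⟨ht.1, ht.2.le⟩)
    (by simp [hw, hz0, hz0']) 1 (by simp)
  rw [sub_zero, zero_add, gron_lin, Real.dist_eq, NNReal.coe_mul, Real.coe_toNNReal _ hρ.le] at key
  have e : w 1 = z 1 + F (p₀ + v, z 1) h := by simp [hw]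
  rw [e] at key
  calc _ = |z' 1 - (z 1 + F (p₀ + v, z 1) h)| := by congr 1; ring
    _ ≤ _ := key
    _ = _ := by ring

theorem frob_ball {F : E × ℝ → E →L[ℝ] ℝ} {p₀ : E} {φ₀ r : ℝ} {M K L : NNReal} (hr : 0 < r)
    (hd : ∀ q ∈ Metric.ball (p₀, φ₀) r, DifferentiableAt ℝ F q)
    (hM : ∀ q ∈ Metric.ball (p₀, φ₀) r, ‖F q‖ ≤ M)
    (hK : LipschitzOnWith K F (Metric.ball (p₀, φ₀) r))
    (hL : LipschitzOnWith L (fderiv ℝ F) (Metric.ball (p₀, φ₀) r))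
    (hint : ∀ q ∈ Metric.ball (p₀, φ₀) r, ∀ a b : E,
      fderiv ℝ F q (a, F q a) b = fderiv ℝ F q (b, F q b) a) :
    ∃ ρ > 0, ∃ φ : E → ℝ, φ p₀ = φ₀ ∧ ∀ p ∈ Metric.ball p₀ ρ,
      (p, φ p) ∈ Metric.ball (p₀, φ₀) r ∧ HasFDerivAt φ (F (p, φ p)) p := by
  have hM0 : (0:ℝ) ≤ M := M.2
  obtain ⟨ρ, hρ, hρr, hMρ⟩ : ∃ ρ : ℝ, 0 < ρ ∧ ρ < r ∧ M * ρ ≤ r / 2 := by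
    refine ⟨r / (2 * (M + 1)), by positivity, ?_, ?_⟩
    · rw [div_lt_iff₀ (by positivity)]; nlinarith
    · rw [← mul_div_assoc, div_le_iff₀ (by positivity)]; nlinarith
  choose! z hz0 hz using fun v (hv : ‖v‖ < ρ) => frob_sol hr hρ hρr hMρ hM hK hv
  refine ⟨ρ, hρ, fun p => z (p - p₀) 1, ?_, ?_⟩
  · have h0 : ‖(0:E)‖ < ρ := by simpa using hρ
    have h1 := hz 0 h0
    have := constant_of_has_deriv_right_zero (f := z 0) (a := 0) (b := 1)
      (fun t ht => (h1 t ht).1.continuousWithinAt)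
      (fun t ht => by
        have := (h1 t ⟨ht.1, ht.2.le⟩).1.mono_of_mem_nhdsWithin (Icc_mem_nhdsGE_of_mem ht)
        simpa using this) 1 (by simp)
    simp only [sub_self]
    rw [this, hz0 0 h0]
  · intro p hp
    obtain ⟨v, rfl⟩ : ∃ v, p = p₀ + v := ⟨p - p₀, by simp⟩
    have hv : ‖v‖ < ρ := by simpa using hp
    simp only [add_sub_cancel_left]
    constructor
    · have := mem_ball_aux (p₀ := p₀) (φ₀ := φ₀) (t := 1) (s := z v 1) hr (hv.trans hρr) (by simp)
        (by linarith [(hz v hv 1 (by simp)).2])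
      simpa using this
    · rw [hasFDerivAt_iff_isLittleO_nhds_zero]
      refine Asymptotics.IsBigO.trans_isLittleO (g := fun h : E => ‖h‖ ^ 2) ?_ ?_
      · apply Asymptotics.IsBigO.of_bound
          ((L * (1 + M) ^ 2 * ρ + K * (1 + M)) * gronwallBound 0 (K * ρ) 1 1)
        have c1 : ∀ᶠ h : E in nhds 0, ‖v + h‖ < ρ := by
          apply ContinuousAt.eventually_lt (by fun_prop) (by fun_prop)
          simpa using hv
        have c2 : ∀ᶠ h : E in nhds 0, M * ‖h‖ < r / 2 := by
          apply ContinuousAt.eventually_lt (by fun_prop) (by fun_prop)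
          simpa using hr
        filter_upwards [c1, c2] with h h1 h2
        have := frob_est hr hρ hρr hd hM hK hL hint hv h1 h2 (hz0 v hv) (hz0 _ h1) (hz v hv)
          (hz _ h1)
        simpa [add_assoc] using this
      · simpa using (Asymptotics.isLittleO_norm_pow_id (E' := E) one_lt_two)

theorem frob_smooth {F : E × ℝ → E →L[ℝ] ℝ} {Ω : Set (E × ℝ)}
    (hF : ContDiffOn ℝ (⊤ : ℕ∞) F Ω) {V : Set E} (hV : IsOpen V) {φ : E → ℝ}
    (hφ : ∀ p ∈ V, (p, φ p) ∈ Ω ∧ HasFDerivAt φ (F (p, φ p)) p) :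
    ContDiffOn ℝ (⊤ : ℕ∞) φ V := by
  rw [contDiffOn_infty]
  intro n
  induction n with
  | zero =>
    simp only [Nat.cast_zero, contDiffOn_zero]
    exact fun p hp => (hφ p hp).2.continuousAt.continuousWithinAt
  | succ n ih =>
    push_cast
    rw [contDiffOn_succ_iff_fderiv_of_isOpen hV]
    refine ⟨fun p hp => (hφ p hp).2.differentiableAt.differentiableWithinAt, by simp, ?_⟩
    have : ContDiffOn ℝ n (fun p => F (p, φ p)) V :=
      (contDiffOn_infty.1 hF n).comp (contDiffOn_id.prodMk ih) (fun p hp => (hφ p hp).1)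
    exact this.congr (fun p hp => (hφ p hp).2.fderiv)

theorem frob {F : E × ℝ → E →L[ℝ] ℝ} {Ω : Set (E × ℝ)} (hΩ : IsOpen Ω)
    (hF : ContDiffOn ℝ (⊤ : ℕ∞) F Ω)
    (hint : ∀ q ∈ Ω, ∀ a b : E,
      fderiv ℝ F q (a, F q a) b = fderiv ℝ F q (b, F q b) a) {p₀ : E} {φ₀ : ℝ}
    (h0 : (p₀, φ₀) ∈ Ω) :
    ∃ V : Set E, IsOpen V ∧ p₀ ∈ V ∧ ∃ φ : E → ℝ, ContDiffOn ℝ (⊤ : ℕ∞) φ V ∧ φ p₀ = φ₀ ∧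
      ∀ p ∈ V, (p, φ p) ∈ Ω ∧ HasFDerivAt φ (F (p, φ p)) p := by
  have hFat : ContDiffAt ℝ (⊤ : ℕ∞) F (p₀, φ₀) := hF.contDiffAt (hΩ.mem_nhds h0)
  obtain ⟨K, s, hs, hK⟩ := (hFat.of_le (m := 1) (by exact_mod_cast le_top)).exists_lipschitzOnWith
  obtain ⟨L, s', hs', hL⟩ := ((hFat.fderiv_right (m := 1)
    (show ((1 + 1 : ℕ∞) : WithTop ℕ∞) ≤ _ from WithTop.coe_le_coe.2 le_top))).exists_lipschitzOnWith
  have hb : ∀ᶠ q in nhds (p₀, φ₀), ‖F q‖ ≤ ‖F (p₀, φ₀)‖₊ + 1 := by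
    have := hFat.continuousAt.norm.eventually_lt (continuousAt_const (y := ‖F (p₀, φ₀)‖ + 1))
      (by linarith)
    filter_upwards [this] with q hq using hq.le
  obtain ⟨r, hr, hball⟩ := Metric.mem_nhds_iff.1
    (Filter.inter_mem (hΩ.mem_nhds h0) (Filter.inter_mem hs (Filter.inter_mem hs' hb)))
  obtain ⟨ρ, hρ, φ, hφ0, hφ⟩ := frob_ball (M := ‖F (p₀, φ₀)‖₊ + 1) hr
    (fun q hq => (hF.contDiffAt (hΩ.mem_nhds (hball hq).1)).differentiableAt (by simp))
    (fun q hq => (hball hq).2.2.2)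
    (hK.mono fun q hq => (hball hq).2.1) (hL.mono fun q hq => (hball hq).2.2.1)
    (fun q hq => hint q (hball hq).1)
  have hφ' : ∀ p ∈ Metric.ball p₀ ρ, (p, φ p) ∈ Ω ∧ HasFDerivAt φ (F (p, φ p)) p :=
    fun p hp => ⟨(hball (hφ p hp).1).1, (hφ p hp).2⟩
  exact ⟨Metric.ball p₀ ρ, Metric.isOpen_ball, Metric.mem_ball_self hρ, φ,
    frob_smooth hF Metric.isOpen_ball hφ', hφ0, hφ'⟩
end

theorem fderiv_split (A : ℝ × ℝ →L[ℝ] ℝ) (v : ℝ × ℝ) :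
    A v = v.1 * A (1, 0) + v.2 * A (0, 1) := by
  have : v = v.1 • ((1:ℝ), (0:ℝ)) + v.2 • ((0:ℝ), (1:ℝ)) := by ext <;> simp
  conv_lhs => rw [this]
  rw [map_add, map_smul, map_smul]; simp

theorem pd_contDiffOn {U : Set (ℝ × ℝ)} (hU : IsOpen U) {u : ℝ × ℝ → ℝ}
    (hu : ContDiffOn ℝ (⊤ : ℕ∞) u U) (e : ℝ × ℝ) :
    ContDiffOn ℝ (⊤ : ℕ∞) (fun p => fderiv ℝ u p e) U :=
  ((contDiffOn_infty_iff_fderiv_of_isOpen hU).1 hu).2.clm_apply contDiffOn_const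

theorem pd_comm {U : Set (ℝ × ℝ)} (hU : IsOpen U) {u : ℝ × ℝ → ℝ}
    (hu : ContDiffOn ℝ (⊤ : ℕ∞) u U) {p : ℝ × ℝ} (hp : p ∈ U) :
    pd1 (pd2 u) p = pd2 (pd1 u) p := by
  have h1 : ContDiffAt ℝ (⊤ : ℕ∞) u p := hu.contDiffAt (hU.mem_nhds hp)
  have hs := h1.isSymmSndFDerivAt
    (by simp only [minSmoothness_of_isRCLikeNormedField]; exact WithTop.coe_le_coe.2 le_top)
  have hd : DifferentiableAt ℝ (fderiv ℝ u) p :=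
    ((((contDiffOn_infty_iff_fderiv_of_isOpen hU).1 hu).2).contDiffAt
      (hU.mem_nhds hp)).differentiableAt (by simp)
  have key : ∀ e : ℝ × ℝ, ∀ f, fderiv ℝ (fun p => fderiv ℝ u p e) p f
      = fderiv ℝ (fderiv ℝ u) p f e := by
    intro e f
    rw [(hd.hasFDerivAt.clm_apply (hasFDerivAt_const e p)).fderiv]
    simp
  show fderiv ℝ (fun p => fderiv ℝ u p (0, 1)) p (1, 0)
    = fderiv ℝ (fun p => fderiv ℝ u p (1, 0)) p (0, 1)
  rw [key, key]
  exact hs _ _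

noncomputable def sgF (u : ℝ × ℝ → ℝ) (q : (ℝ × ℝ) × ℝ) : ℝ × ℝ →L[ℝ] ℝ :=
  (pd2 u q.1 / 2 + sin q.2 * cos (u q.1 / 2)) • ContinuousLinearMap.fst ℝ ℝ ℝ +
  (pd1 u q.1 / 2 + cos q.2 * sin (u q.1 / 2)) • ContinuousLinearMap.snd ℝ ℝ ℝ

theorem sgF_apply (u : ℝ × ℝ → ℝ) (q : (ℝ × ℝ) × ℝ) (v : ℝ × ℝ) :
    sgF u q v = (pd2 u q.1 / 2 + sin q.2 * cos (u q.1 / 2)) * v.1 +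
      (pd1 u q.1 / 2 + cos q.2 * sin (u q.1 / 2)) * v.2 := by
  simp [sgF]

theorem sgF_contDiffOn {U : Set (ℝ × ℝ)} (hU : IsOpen U) {u : ℝ × ℝ → ℝ}
    (hu : ContDiffOn ℝ (⊤ : ℕ∞) u U) :
    ContDiffOn ℝ (⊤ : ℕ∞) (sgF u) (Prod.fst ⁻¹' U) := by
  have hm : Set.MapsTo (Prod.fst : (ℝ × ℝ) × ℝ → ℝ × ℝ) (Prod.fst ⁻¹' U) U := fun q hq => hq
  have h0 : ContDiffOn ℝ (⊤ : ℕ∞) (fun q : (ℝ × ℝ) × ℝ => u q.1) (Prod.fst ⁻¹' U) :=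
    hu.comp contDiffOn_fst hm
  have h1 : ContDiffOn ℝ (⊤ : ℕ∞) (fun q : (ℝ × ℝ) × ℝ => pd1 u q.1) (Prod.fst ⁻¹' U) :=
    (pd_contDiffOn hU hu (1, 0)).comp contDiffOn_fst hm
  have h2 : ContDiffOn ℝ (⊤ : ℕ∞) (fun q : (ℝ × ℝ) × ℝ => pd2 u q.1) (Prod.fst ⁻¹' U) :=
    (pd_contDiffOn hU hu (0, 1)).comp contDiffOn_fst hm
  have h3 : ContDiffOn ℝ (⊤ : ℕ∞) (fun q : (ℝ × ℝ) × ℝ => q.2) (Prod.fst ⁻¹' U) := contDiffOn_snd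
  unfold sgF
  exact (((h2.div_const 2).add (h3.sin.mul (h0.div_const 2).cos)).smul contDiffOn_const).add
    (((h1.div_const 2).add (h3.cos.mul (h0.div_const 2).sin)).smul contDiffOn_const)

theorem sgF_int {U : Set (ℝ × ℝ)} (hU : IsOpen U) {u : ℝ × ℝ → ℝ}
    (hu : ContDiffOn ℝ (⊤ : ℕ∞) u U)
    (hSG : ∀ p ∈ U, pd1 (pd1 u) p - pd2 (pd2 u) p = sin (u p))
    (q : (ℝ × ℝ) × ℝ) (hq : q.1 ∈ U) (a b : ℝ × ℝ) :
    fderiv ℝ (sgF u) q (a, sgF u q a) b = fderiv ℝ (sgF u) q (b, sgF u q b) a := by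
  have g0 : HasFDerivAt (fun q : (ℝ × ℝ) × ℝ => u q.1)
      ((fderiv ℝ u q.1).comp (ContinuousLinearMap.fst ℝ (ℝ × ℝ) ℝ)) q :=
    ((hu.contDiffAt (hU.mem_nhds hq)).differentiableAt (by simp)).hasFDerivAt.comp q hasFDerivAt_fst
  have g1 : HasFDerivAt (fun q : (ℝ × ℝ) × ℝ => pd1 u q.1)
      ((fderiv ℝ (pd1 u) q.1).comp (ContinuousLinearMap.fst ℝ (ℝ × ℝ) ℝ)) q :=
    (((pd_contDiffOn hU hu (1, 0)).contDiffAt (hU.mem_nhds hq)).differentiableAt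
      (by simp)).hasFDerivAt.comp q hasFDerivAt_fst
  have g2 : HasFDerivAt (fun q : (ℝ × ℝ) × ℝ => pd2 u q.1)
      ((fderiv ℝ (pd2 u) q.1).comp (ContinuousLinearMap.fst ℝ (ℝ × ℝ) ℝ)) q :=
    (((pd_contDiffOn hU hu (0, 1)).contDiffAt (hU.mem_nhds hq)).differentiableAt
      (by simp)).hasFDerivAt.comp q hasFDerivAt_fst
  have g3 : HasFDerivAt (fun q : (ℝ × ℝ) × ℝ => q.2) (ContinuousLinearMap.snd ℝ (ℝ × ℝ) ℝ) q :=
    hasFDerivAt_snd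
  have G := (((g2.mul_const (2⁻¹:ℝ)).add (g3.sin.mul (g0.mul_const (2⁻¹:ℝ)).cos)).smul_const
      (ContinuousLinearMap.fst ℝ ℝ ℝ)).add
    (((g1.mul_const (2⁻¹:ℝ)).add (g3.cos.mul (g0.mul_const (2⁻¹:ℝ)).sin)).smul_const
      (ContinuousLinearMap.snd ℝ ℝ ℝ))
  rw [(G.congr_of_eventuallyEq (f₁ := sgF u)
    (Filter.Eventually.of_forall fun q' => by simp [sgF, div_eq_mul_inv])).fderiv]
  have k0 : ∀ v, fderiv ℝ u q.1 v = v.1 * pd1 u q.1 + v.2 * pd2 u q.1 := fderiv_split _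
  have k1 : ∀ v, fderiv ℝ (pd1 u) q.1 v = v.1 * pd1 (pd1 u) q.1 + v.2 * pd2 (pd1 u) q.1 :=
    fderiv_split _
  have k2 : ∀ v, fderiv ℝ (pd2 u) q.1 v = v.1 * pd1 (pd2 u) q.1 + v.2 * pd2 (pd2 u) q.1 :=
    fderiv_split _
  have hc := pd_comm hU hu hq
  have hsg := hSG q.1 hq
  have hsin : sin (u q.1) = 2 * sin (u q.1 * 2⁻¹) * cos (u q.1 * 2⁻¹) := by
    rw [← sin_two_mul]; congr 1; ring
  have hp := sin_sq_add_cos_sq q.2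
  simp only [ContinuousLinearMap.add_apply, ContinuousLinearMap.smulRight_apply,
    ContinuousLinearMap.smul_apply, ContinuousLinearMap.comp_apply, ContinuousLinearMap.coe_fst',
    ContinuousLinearMap.coe_snd', smul_eq_mul, sgF_apply, k0 a, k0 b, k1 a, k1 b, k2 a, k2 b,
    div_eq_mul_inv, ContinuousLinearMap.coe_comp', Function.comp_apply, add_apply, smul_apply]
  rw [hc]
  rw [hsin] at hsg
  generalize sin (u q.1 * 2⁻¹) = S at *
  generalize cos (u q.1 * 2⁻¹) = T at *
  linear_combination (a.1 * b.2 - a.2 * b.1) / 2 * hsg - (a.1 * b.2 - a.2 * b.1) * S * T * hp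

theorem sg_unique_ball {W : Set (ℝ × ℝ)} (hW : IsOpen W) {u φ ψ : ℝ × ℝ → ℝ}
    (hφ : ContDiffOn ℝ (⊤ : ℕ∞) φ W) (hφs : SGAngleSystem u φ W)
    (hψ : ContDiffOn ℝ (⊤ : ℕ∞) ψ W) (hψs : SGAngleSystem u ψ W)
    {q : ℝ × ℝ} {ε : ℝ} (hb : Metric.ball q ε ⊆ W) (hq : φ q = ψ q) :
    ∀ p ∈ Metric.ball q ε, φ p = ψ p := by
  intro p hp
  obtain ⟨v, rfl⟩ : ∃ v, p = q + v := ⟨p - q, by simp⟩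
  have hv : ‖v‖ < ε := by simpa using hp
  have hmem : ∀ t ∈ Set.Icc (0:ℝ) 1, q + t • v ∈ W := by
    intro t ht
    apply hb
    simp only [Metric.mem_ball, dist_eq_norm, add_sub_cancel_left, norm_smul, Real.norm_eq_abs]
    rw [abs_of_nonneg ht.1]
    nlinarith [ht.2, norm_nonneg v]
  have hl : ∀ t, HasDerivAt (fun t : ℝ => q + t • v) v t := by
    intro t
    simpa using ((hasDerivAt_id t).smul_const v).const_add q
  have hder : ∀ f : ℝ × ℝ → ℝ, ContDiffOn ℝ (⊤ : ℕ∞) f W → ∀ t ∈ Set.Icc (0:ℝ) 1,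
      HasDerivAt (fun t : ℝ => f (q + t • v))
        (v.1 * pd1 f (q + t • v) + v.2 * pd2 f (q + t • v)) t := by
    intro f hf t ht
    have h1 := ((hf.contDiffAt (hW.mem_nhds (hmem t ht))).differentiableAt
      (by simp)).hasFDerivAt.comp_hasDerivAt t (hl t)
    rw [fderiv_split] at h1
    exact h1
  have hd := fun t ht => (hder φ hφ t ht).sub (hder ψ hψ t ht)
  have := eq_zero_of_abs_deriv_le_mul_abs_self_of_eq_zero_right (K := 2 * ‖v‖) (a := 0) (b := 1)
    (fun t ht => (hd t ht).continuousAt.continuousWithinAt)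
    (fun t ht => (hd t ⟨ht.1, ht.2.le⟩).hasDerivWithinAt) (by simp [hq])
    (by
      intro t ht'
      have ht : t ∈ Set.Icc (0:ℝ) 1 := ⟨ht'.1, ht'.2.le⟩
      obtain ⟨a1, a2⟩ := hφs _ (hmem t ht)
      obtain ⟨b1, b2⟩ := hψs _ (hmem t ht)
      rw [a1, a2, b1, b2]
      simp only [Pi.sub_apply, Real.norm_eq_abs]
      generalize q + t • v = p
      have e : v.1 * (pd2 u p / 2 + sin (φ p) * cos (u p / 2)) +
          v.2 * (pd1 u p / 2 + cos (φ p) * sin (u p / 2)) -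
          (v.1 * (pd2 u p / 2 + sin (ψ p) * cos (u p / 2)) +
          v.2 * (pd1 u p / 2 + cos (ψ p) * sin (u p / 2))) =
          v.1 * cos (u p / 2) * (sin (φ p) - sin (ψ p)) +
          v.2 * sin (u p / 2) * (cos (φ p) - cos (ψ p)) := by ring
      rw [e]
      refine (abs_add_le _ _).trans ?_
      rw [abs_mul, abs_mul, abs_mul, abs_mul]
      have n1 : |v.1| ≤ ‖v‖ := norm_fst_le v
      have n2 : |v.2| ≤ ‖v‖ := norm_snd_le v
      have c1 := abs_cos_le_one (u p / 2)
      have c2 := abs_sin_le_one (u p / 2)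
      have d1 := abs_sin_sub_sin_le (φ p) (ψ p)
      have d2 := abs_cos_sub_cos_le (φ p) (ψ p)
      calc _ ≤ ‖v‖ * 1 * |φ p - ψ p| + ‖v‖ * 1 * |φ p - ψ p| := by gcongr
        _ = _ := by ring)
    1 (by simp)
  simp only [Pi.sub_apply, one_smul] at this
  linarith

theorem statement10 (U : Set (ℝ × ℝ)) (hU : IsOpen U)
    (u : ℝ × ℝ → ℝ) (hu : ContDiffOn ℝ (⊤ : ℕ∞) u U)
    (hSG : ∀ p ∈ U, pd1 (pd1 u) p - pd2 (pd2 u) p = sin (u p)) :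
    ∀ p₀ ∈ U, ∀ φ₀ : ℝ,
      (∃ V : Set (ℝ × ℝ), IsOpen V ∧ p₀ ∈ V ∧ V ⊆ U ∧
        ∃ φ : ℝ × ℝ → ℝ, ContDiffOn ℝ (⊤ : ℕ∞) φ V ∧ φ p₀ = φ₀ ∧ SGAngleSystem u φ V) ∧
      (∀ W : Set (ℝ × ℝ), IsOpen W → IsConnected W → p₀ ∈ W → W ⊆ U →
        ∀ φ ψ : ℝ × ℝ → ℝ,
          ContDiffOn ℝ (⊤ : ℕ∞) φ W → SGAngleSystem u φ W →
          ContDiffOn ℝ (⊤ : ℕ∞) ψ W → SGAngleSystem u ψ W →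
          φ p₀ = ψ p₀ → Set.EqOn φ ψ W) := by
  intro p₀ hp₀ φ₀
  constructor
  · obtain ⟨V, hV, hpV, φ, hφ, hφ0, h⟩ := frob (F := sgF u) (Ω := Prod.fst ⁻¹' U)
      (hU.preimage continuous_fst) (sgF_contDiffOn hU hu)
      (fun q hq => sgF_int hU hu hSG q hq) (p₀ := p₀) (φ₀ := φ₀) hp₀
    refine ⟨V, hV, hpV, fun p hp => (h p hp).1, φ, hφ, hφ0, fun p hp => ?_⟩
    unfold pd1 pd2
    rw [(h p hp).2.fderiv]
    constructor
    · rw [sgF_apply]; simp [pd2]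
    · rw [sgF_apply]; simp [pd1]
  · intro W hW hWc hpW _ φ ψ hφ hφs hψ hψs h0
    have hsub : W ⊆ {p | p ∈ W ∧ φ p = ψ p} := by
      apply hWc.isPreconnected.subset_of_closure_inter_subset
      · rw [Metric.isOpen_iff]
        rintro q ⟨hq, hqe⟩
        obtain ⟨ε, hε, hb⟩ := Metric.isOpen_iff.1 hW q hq
        exact ⟨ε, hε, fun p hp => ⟨hb hp, sg_unique_ball hW hφ hφs hψ hψs hb hqe p hp⟩⟩
      · exact ⟨p₀, hpW, hpW, h0⟩
      · rintro q ⟨hq, hqW⟩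
        refine ⟨hqW, ?_⟩
        have c1 := (hφ.continuousOn.continuousAt (hW.mem_nhds hqW))
        have c2 := (hψ.continuousOn.continuousAt (hW.mem_nhds hqW))
        have : (nhdsWithin q {p | p ∈ W ∧ φ p = ψ p}).NeBot := mem_closure_iff_nhdsWithin_neBot.1 hq
        refine tendsto_nhds_unique_of_eventuallyEq
          (c1.mono_left (nhdsWithin_le_nhds (s := {p | p ∈ W ∧ φ p = ψ p})))
          (c2.mono_left nhdsWithin_le_nhds) ?_
        filter_upwards [self_mem_nhdsWithin] with p hp using hp.2
    exact fun p hp => (hsub hp).2
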